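/- In the Berwald frame setting, assume additionally that N is connected, that the vector fields S, H, V, C span the tangent space of N at every point, that C K = 0 (K is 0-homogeneous), that S I = 0 and H I = 0 (the Berwald condition), and that K is nowhere zero on N. Then H K = 0 if and only if K is a constant function; i.e., for a Berwald surface with non-vanishing flag curvature, the flag curvature is H-invariant if and only if it is constant. -/

import Mathlib

/-- Derivative `X f` of a function `f` along a vector field `X`:
`(X f)(p) = df_p(X(p))`. -/
noncomputable def dAlong {E : Type*} [NormedAddCommGroup E] [NormedSpace ℝ E]
    (X : E → E) (f : E → ℝ) : E → ℝ :=
  fun p => fderiv ℝ f p (X p)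

/-- Lie bracket `[X,Y]` of two vector fields. -/
noncomputable def lieB {E : Type*} [NormedAddCommGroup E] [NormedSpace ℝ E]
    (X Y : E → E) : E → E :=
  fun p => fderiv ℝ Y p (X p) - fderiv ℝ X p (Y p)

/-- The Lie bracket acts on functions as the commutator of derivations. -/
theorem dAlong_lieB {E : Type*} [NormedAddCommGroup E] [NormedSpace ℝ E]
    {X Y : E → E} {f : E → ℝ} {p : E} (hX : DifferentiableAt ℝ X p)
    (hY : DifferentiableAt ℝ Y p) (hf : ContDiffAt ℝ 2 f p) :
    dAlong X (dAlong Y f) p - dAlong Y (dAlong X f) p = fderiv ℝ f p (lieB X Y p) := by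
  have hdf : DifferentiableAt ℝ (fderiv ℝ f) p :=
    (hf.fderiv_right (m := 1) (by norm_num)).differentiableAt (by norm_num)
  have hsymm : IsSymmSndFDerivAt ℝ f p := hf.isSymmSndFDerivAt (by simp)
  unfold dAlong lieB
  rw [fderiv_clm_apply hdf hY, fderiv_clm_apply hdf hX]
  simp [hsymm.eq (X p) (Y p)]

theorem dAlong_congr_of_isOpen {E : Type*} [NormedAddCommGroup E] [NormedSpace ℝ E]
    {N : Set E} (hN : IsOpen N) (X : E → E) {f g : E → ℝ} (h : ∀ q ∈ N, f q = g q)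
    {p : E} (hp : p ∈ N) : dAlong X f p = dAlong X g p := by
  have hfg : f =ᶠ[nhds p] g := Filter.eventually_of_mem (hN.mem_nhds hp) h
  simp only [dAlong, hfg.fderiv_eq]

theorem dAlong_const {E : Type*} [NormedAddCommGroup E] [NormedSpace ℝ E]
    (X : E → E) (c : ℝ) (p : E) : dAlong X (fun _ => c) p = 0 := by
  simp [dAlong]

theorem ContDiffOn.differentiableAt_of_isOpen {E F : Type*} [NormedAddCommGroup E]
    [NormedSpace ℝ E] [NormedAddCommGroup F] [NormedSpace ℝ F] {N : Set E} {f : E → F}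
    (hf : ContDiffOn ℝ (⊤ : ℕ∞) f N) (hN : IsOpen N) {p : E} (hp : p ∈ N) :
    DifferentiableAt ℝ f p :=
  (hf.contDiffAt (hN.mem_nhds hp)).differentiableAt (by simp)

/-- In the Berwald frame setting, assume moreover that `N`
is connected, that `S, H, V, C` span the tangent space at every point of
`N`, that `C K = 0` (`K` is 0-homogeneous), that `S I = 0` and `H I = 0`
(the Berwald condition), and that `K` is nowhere zero on `N`.  Then
`H K = 0` iff `K` is constant: for a Berwald surface with non-vanishing flag
curvature, the flag curvature is `H`-invariant iff it is constant. -/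
theorem statement15
    {E : Type*} [NormedAddCommGroup E] [NormedSpace ℝ E]
    (N : Set E) (hNopen : IsOpen N)
    (S H V C : E → E) (K I : E → ℝ)
    (hS : ContDiffOn ℝ (⊤ : ℕ∞) S N) (hH : ContDiffOn ℝ (⊤ : ℕ∞) H N)
    (hV : ContDiffOn ℝ (⊤ : ℕ∞) V N) (hC : ContDiffOn ℝ (⊤ : ℕ∞) C N)
    (hK : ContDiffOn ℝ (⊤ : ℕ∞) K N) (hI : ContDiffOn ℝ (⊤ : ℕ∞) I N)
    (hSH : ∀ p ∈ N, lieB S H p = K p • V p)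
    (hSV : ∀ p ∈ N, lieB S V p = -(H p))
    (hHV : ∀ p ∈ N, lieB H V p = S p + I p • H p + dAlong S I p • V p)
    (hBianchi : ∀ p ∈ N, dAlong S (dAlong S I) p + dAlong V K p + I p * K p = 0)
    (hNconn : IsConnected N)
    (hspan : ∀ p ∈ N, Submodule.span ℝ ({S p, H p, V p, C p} : Set E) = ⊤)
    (hCK : ∀ p ∈ N, dAlong C K p = 0)
    (hSI : ∀ p ∈ N, dAlong S I p = 0)
    (hHI : ∀ p ∈ N, dAlong H I p = 0)
    (hKne : ∀ p ∈ N, K p ≠ 0) :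
    (∀ p ∈ N, dAlong H K p = 0) ↔ ∃ c : ℝ, ∀ p ∈ N, K p = c := by
  have hK2 : ∀ p ∈ N, ContDiffAt ℝ 2 K p := fun p hp =>
    (hK.contDiffAt (hNopen.mem_nhds hp)).of_le (WithTop.coe_le_coe.2 le_top)
  constructor
  · intro hHK
    have hVK : ∀ p ∈ N, dAlong V K p = -(I p * K p) := fun p hp => by
      have h := hBianchi p hp
      rw [dAlong_congr_of_isOpen hNopen S hSI hp, dAlong_const] at h
      linarith
    have hSK : ∀ p ∈ N, dAlong S K p = 0 := fun p hp => by
      have h := dAlong_lieB (hH.differentiableAt_of_isOpen hNopen hp)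
        (hV.differentiableAt_of_isOpen hNopen hp) (hK2 p hp)
      have hIK : dAlong H (fun q => -(I q * K q)) p =
          -(I p * dAlong H K p + K p * dAlong H I p) := by
        unfold dAlong
        rw [fderiv_fun_neg, fderiv_fun_mul (hI.differentiableAt_of_isOpen hNopen hp) 
          (hK.differentiableAt_of_isOpen hNopen hp)]
        simp
      rw [dAlong_congr_of_isOpen hNopen H hVK hp, dAlong_congr_of_isOpen hNopen V hHK hp,
        dAlong_const, hIK, hHK p hp, hHI p hp, hHV p hp, hSI p hp] at h
      have hHKp : fderiv ℝ K p (H p) = 0 := hHK p hp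
      simpa [hHKp, dAlong] using h.symm
    have hVK0 : ∀ p ∈ N, dAlong V K p = 0 := fun p hp => by
      have h := dAlong_lieB (hS.differentiableAt_of_isOpen hNopen hp)
        (hH.differentiableAt_of_isOpen hNopen hp) (hK2 p hp)
      rw [dAlong_congr_of_isOpen hNopen S hHK hp, dAlong_congr_of_isOpen hNopen H hSK hp,
        dAlong_const, dAlong_const, hSH p hp] at h
      simpa [hKne p hp, dAlong] using h.symm
    have hdK : Set.EqOn (fderiv ℝ K) 0 N := fun p hp => by
      apply ContinuousLinearMap.coe_injective
      refine LinearMap.ext_on (hspan p hp) ?_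
      rintro v (rfl | rfl | rfl | rfl)
      exacts [hSK p hp, hHK p hp, hVK0 p hp, hCK p hp]
    exact hNopen.exists_is_const_of_fderiv_eq_zero hNconn.isPreconnected
      (fun p hp => (hK.differentiableAt_of_isOpen hNopen hp).differentiableWithinAt) hdK
  · rintro ⟨c, hc⟩ p hp
    rw [dAlong_congr_of_isOpen hNopen H hc hp, dAlong_const]
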